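/- The universality problem for TOPL automata is undecidable: taking V = ℕ (so that automata admit finite descriptions), the set of TOPL automata A over V^n with L(A) = (V^n)* is not a computable predicate on (codes of) automata; i.e. there is no algorithm that, given a TOPL automaton A, decides whether L(A) is the set of all words. -/

import Mathlib

namespace Topl

/-- A (code for a) guard: a finite conjunction of literals `(b, i, j)`, where `b = true`
means `eq i j` (register `i` equals component `j` of the letter), `b = false` means
`neq i j`, and the empty conjunction is the guard `true`. -/
abbrev GuardC : Type := List (Bool × ℕ × ℕ)

/-- A (code for an) action: a finite sequence of assignments `set i := j`;
the empty sequence is `nop`. -/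
abbrev ActionC : Type := List (ℕ × ℕ)

/-- A code for a TOPL automaton over `V = ℕ`, with `m` registers, arity `n`,
states `{0, …, k−1}`, initial state `q0`, initial store `s0`,
transition list `delta` and final states `F`. -/
structure ToplC where
  m : ℕ
  n : ℕ
  k : ℕ
  q0 : ℕ
  s0 : List ℕ
  delta : List (ℕ × (GuardC × ActionC) × ℕ)
  F : List ℕ

def toplCEquiv : ToplC ≃ ℕ × ℕ × ℕ × ℕ × List ℕ × List (ℕ × (GuardC × ActionC) × ℕ) × List ℕ where
  toFun A := (A.m, A.n, A.k, A.q0, A.s0, A.delta, A.F)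
  invFun p := ⟨p.1, p.2.1, p.2.2.1, p.2.2.2.1, p.2.2.2.2.1, p.2.2.2.2.2.1, p.2.2.2.2.2.2⟩
  left_inv A := rfl
  right_inv p := rfl

instance : Primcodable ToplC := Primcodable.ofEquiv _ toplCEquiv

/-- Satisfaction of a guard by a store `s` and a letter `ℓ` (both given as lists). -/
def GuardC.Sat (s ℓ : List ℕ) (g : GuardC) : Prop :=
  ∀ p ∈ g, (p.1 = true → s.getD p.2.1 0 = ℓ.getD p.2.2 0) ∧
           (p.1 = false → s.getD p.2.1 0 ≠ ℓ.getD p.2.2 0)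

/-- The store transformation of an action on input letter `ℓ`. -/
def ActionC.run (ℓ : List ℕ) (a : ActionC) (s : List ℕ) : List ℕ :=
  a.foldl (fun s p => s.set p.1 (ℓ.getD p.2 0)) s

/-- One edge of the configuration graph. -/
def ToplC.Step (A : ToplC) (x₁ : ℕ × List ℕ) (ℓ : List ℕ) (x₂ : ℕ × List ℕ) : Prop :=
  ∃ g a, (x₁.1, (g, a), x₂.1) ∈ A.delta ∧ GuardC.Sat x₁.2 ℓ g ∧ ActionC.run ℓ a x₁.2 = x₂.2

/-- Walks in the configuration graph, labelled by words. -/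
inductive ToplC.Reach (A : ToplC) : ℕ × List ℕ → List (List ℕ) → ℕ × List ℕ → Prop
  | nil (x) : ToplC.Reach A x [] x
  | cons {x₁ x₂ x₃ ℓ w} : A.Step x₁ ℓ x₂ → ToplC.Reach A x₂ w x₃ → ToplC.Reach A x₁ (ℓ :: w) x₃

/-- The language of a coded TOPL automaton: words over the alphabet `ℕ^n`
(letters are lists of length `n`) labelling walks from the initial configuration
to a configuration whose state is final. -/
def ToplC.Lang (A : ToplC) : Set (List (List ℕ)) :=
  { w | (∀ ℓ ∈ w, ℓ.length = A.n) ∧ ∃ x, A.Reach (A.q0, A.s0) w x ∧ x.1 ∈ A.F }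

/-- Well-formedness: the code really describes a TOPL automaton with `m` registers over
`n`-tuples and `k` states. -/
def ToplC.WF (A : ToplC) : Prop :=
  A.q0 < A.k ∧ A.s0.length = A.m ∧ (∀ q ∈ A.F, q < A.k) ∧
  ∀ t ∈ A.delta, t.1 < A.k ∧ t.2.2 < A.k ∧
    (∀ p ∈ t.2.1.1, p.2.1 < A.m ∧ p.2.2 < A.n) ∧
    (∀ p ∈ t.2.1.2, p.1 < A.m ∧ p.2 < A.n)

/-- All words over the alphabet `ℕ^n`. -/
def fullLang (n : ℕ) : Set (List (List ℕ)) := { w | ∀ ℓ ∈ w, ℓ.length = n }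

open Turing.ToPartrec (Code)

/-- Control of the evaluator: either about to run a code or returning a value. -/
inductive Ctl
  | ret
  | run (c : Code)

/-- Tags of continuation frames. -/
inductive Tag
  | fst (f : Code)
  | snd
  | cmp (f : Code)
  | fx (f : Code)

/-- Configurations of a small-step evaluator for `Turing.ToPartrec.Code`. -/
structure Cfg where
  ctl : Ctl
  val : List ℕ
  stk : List (Tag × List ℕ)

/-- The transition function of the evaluator. -/
def Cfg.next : Cfg → Option Cfg
  | ⟨.run .zero', v, k⟩ => some ⟨.ret, 0 :: v, k⟩
  | ⟨.run .succ, v, k⟩ => some ⟨.ret, [v.headI + 1], k⟩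
  | ⟨.run .tail, v, k⟩ => some ⟨.ret, v.tail, k⟩
  | ⟨.run (.cons f fs), v, k⟩ => some ⟨.run fs, v, (.fst f, v) :: k⟩
  | ⟨.run (.comp f g), v, k⟩ => some ⟨.run g, v, (.cmp f, v) :: k⟩
  | ⟨.run (.case f g), v, k⟩ =>
      if v.headI = 0 then some ⟨.run f, v.tail, k⟩
      else some ⟨.run g, (v.headI - 1) :: v.tail, k⟩
  | ⟨.run (.fix f), v, k⟩ => some ⟨.run f, v, (.fx f, v) :: k⟩
  | ⟨.ret, _, []⟩ => none
  | ⟨.ret, v, (.fst f, a) :: k⟩ => some ⟨.run f, a, (.snd, v) :: k⟩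
  | ⟨.ret, v, (.snd, a) :: k⟩ => some ⟨.ret, v.headI :: a, k⟩
  | ⟨.ret, v, (.cmp f, _) :: k⟩ => some ⟨.run f, v, k⟩
  | ⟨.ret, v, (.fx f, a) :: k⟩ =>
      if v.headI = 0 then some ⟨.ret, v.tail, k⟩
      else some ⟨.run f, v.tail, (.fx f, a) :: k⟩

/-- The evaluator stops after exactly `n` transitions. -/
def HaltsIn : ℕ → Cfg → Prop
  | 0, a => a.next = none
  | n + 1, a => ∃ b, a.next = some b ∧ HaltsIn n b

/-- The evaluator eventually stops. -/
def Halts (a : Cfg) : Prop := ∃ n, HaltsIn n a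

theorem Halts.of_next {a b : Cfg} (h : a.next = some b) : Halts b → Halts a
  | ⟨n, hn⟩ => ⟨n + 1, b, h, hn⟩

theorem HaltsIn.of_next {n : ℕ} {a b : Cfg} (hn : HaltsIn n a) (h : a.next = some b) :
    ∃ m, m < n ∧ HaltsIn m b := by
  cases n with
  | zero => simp [HaltsIn, h] at hn
  | succ n =>
    obtain ⟨b', hb, hn⟩ := hn
    obtain rfl : b = b' := by simpa [h] using hb
    exact ⟨n, n.lt_succ_self, hn⟩

theorem halts_run_of_mem_eval {c : Code} : ∀ {v r : List ℕ} {k : List (Tag × List ℕ)},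
    r ∈ c.eval v → Halts ⟨.ret, r, k⟩ → Halts ⟨.run c, v, k⟩ := by
  induction c with
  | zero' =>
    intro v r k hr h
    simp [Part.pure_eq_some] at hr
    subst hr; exact h.of_next rfl
  | succ =>
    intro v r k hr h
    simp [Part.pure_eq_some] at hr
    subst hr; exact h.of_next rfl
  | tail =>
    intro v r k hr h
    simp [Part.pure_eq_some] at hr
    subst hr; exact h.of_next rfl
  | cons f fs ihf ihfs =>
    intro v r k hr h
    simp [Part.pure_eq_some, Part.bind_eq_bind] at hr
    obtain ⟨n, hn, ns, hns, rfl⟩ := hr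
    refine Halts.of_next rfl (ihfs hns ?_)
    refine Halts.of_next rfl (ihf hn ?_)
    exact h.of_next rfl
  | comp f g ihf ihg =>
    intro v r k hr h
    rw [Code.comp_eval] at hr
    obtain ⟨u, hu, hr⟩ := Part.mem_bind_iff.1 hr
    exact Halts.of_next rfl (ihg hu (Halts.of_next rfl (ihf hr h)))
  | case f g ihf ihg =>
    intro v r k hr h
    rw [Code.case_eval] at hr
    rcases e : v.headI with _ | y
    · simp only [e] at hr
      exact Halts.of_next (b := ⟨.run f, v.tail, k⟩) (by simp [Cfg.next, e]) (ihf hr h)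
    · simp only [e] at hr
      exact Halts.of_next (b := ⟨.run g, y :: v.tail, k⟩) (by simp [Cfg.next, e]) (ihg hr h)
  | fix f ih =>
    intro v r k hr h
    rw [Code.fix_eval] at hr
    suffices H : ∀ a, Halts ⟨.run f, v, (.fx f, a) :: k⟩ from Halts.of_next rfl (H v)
    refine PFun.fixInduction' (C := fun v => ∀ a, Halts ⟨.run f, v, (.fx f, a) :: k⟩) hr ?_ ?_
    · intro u hu a
      simp only [Part.mem_map_iff] at hu
      obtain ⟨w, hw, e⟩ := hu
      split_ifs at e with h0
      cases e
      exact ih hw (h.of_next (by simp [Cfg.next, h0]))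
    · intro u u' _ hu H a
      simp only [Part.mem_map_iff] at hu
      obtain ⟨w, hw, e⟩ := hu
      split_ifs at e with h0
      cases e
      exact ih hw ((H a).of_next (by simp [Cfg.next, h0]))

theorem HaltsIn.exists_mem_eval {c : Code} : ∀ {n : ℕ} {v : List ℕ} {k : List (Tag × List ℕ)},
    HaltsIn n ⟨.run c, v, k⟩ → ∃ r ∈ c.eval v, ∃ m, m < n ∧ HaltsIn m ⟨.ret, r, k⟩ := by
  induction c with
  | zero' =>
    intro n v k h
    exact ⟨_, by simp [Part.pure_eq_some], h.of_next rfl⟩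
  | succ =>
    intro n v k h
    exact ⟨_, by simp [Part.pure_eq_some], h.of_next rfl⟩
  | tail =>
    intro n v k h
    exact ⟨_, by simp [Part.pure_eq_some], h.of_next rfl⟩
  | cons f fs ihf ihfs =>
    intro n v k h
    obtain ⟨n₁, h₁, h⟩ := h.of_next rfl
    obtain ⟨ns, hns, n₂, h₂, h⟩ := ihfs h
    obtain ⟨n₃, h₃, h⟩ := h.of_next rfl
    obtain ⟨r, hr, n₄, h₄, h⟩ := ihf h
    obtain ⟨n₅, h₅, h⟩ := h.of_next rfl
    refine ⟨r.headI :: ns, ?_, n₅, by omega, h⟩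
    simp only [Code.cons_eval, Part.bind_eq_bind, Part.mem_bind_iff, Part.pure_eq_some]
    exact ⟨r, hr, ns, hns, Part.mem_some _⟩
  | comp f g ihf ihg =>
    intro n v k h
    obtain ⟨n₁, h₁, h⟩ := h.of_next rfl
    obtain ⟨u, hu, n₂, h₂, h⟩ := ihg h
    obtain ⟨n₃, h₃, h⟩ := h.of_next rfl
    obtain ⟨r, hr, n₄, h₄, h⟩ := ihf h
    refine ⟨r, ?_, n₄, by omega, h⟩
    rw [Code.comp_eval]
    exact Part.mem_bind_iff.2 ⟨u, hu, hr⟩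
  | case f g ihf ihg =>
    intro n v k h
    rw [Code.case_eval]
    rcases e : v.headI with _ | y
    · obtain ⟨n₁, h₁, h⟩ := h.of_next (b := ⟨.run f, v.tail, k⟩) (by simp [Cfg.next, e])
      obtain ⟨r, hr, n₂, h₂, h⟩ := ihf h
      exact ⟨r, by simp only [e]; exact hr, n₂, by omega, h⟩
    · obtain ⟨n₁, h₁, h⟩ := h.of_next (b := ⟨.run g, y :: v.tail, k⟩) (by simp [Cfg.next, e])
      obtain ⟨r, hr, n₂, h₂, h⟩ := ihg h
      exact ⟨r, by simp only [e]; exact hr, n₂, by omega, h⟩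
  | fix f ih =>
    intro n v k h
    suffices H : ∀ n v a, HaltsIn n ⟨.run f, v, (.fx f, a) :: k⟩ →
        ∃ r ∈ (Code.fix f).eval v, ∃ m, m < n ∧ HaltsIn m ⟨.ret, r, k⟩ by
      obtain ⟨n₁, h₁, h⟩ := h.of_next rfl
      obtain ⟨r, hr, m, hm, h⟩ := H _ _ _ h
      exact ⟨r, hr, m, by omega, h⟩
    clear h
    intro n
    induction n using Nat.strong_induction_on with
    | _ n IH =>
      intro v a h
      obtain ⟨u, hu, n₂, h₂, h⟩ := ih h
      by_cases h0 : u.headI = 0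
      · obtain ⟨n₃, h₃, h⟩ := h.of_next (b := ⟨.ret, u.tail, k⟩) (by simp [Cfg.next, h0])
        refine ⟨u.tail, ?_, n₃, by omega, h⟩
        rw [Code.fix_eval]
        exact PFun.fix_stop ((Part.mem_map_iff _).2 ⟨u, hu, by simp [h0]⟩)
      · obtain ⟨n₃, h₃, h⟩ := h.of_next (b := ⟨.run f, u.tail, (.fx f, a) :: k⟩)
          (by simp [Cfg.next, h0])
        obtain ⟨r, hr, m, hm, h⟩ := IH n₃ (by omega) _ _ h
        refine ⟨r, ?_, m, by omega, h⟩
        rw [Code.fix_eval] at hr ⊢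
        exact PFun.mem_fix_iff.2
          (.inr ⟨u.tail, (Part.mem_map_iff _).2 ⟨u, hu, by simp [h0]⟩, hr⟩)

/-- The evaluator stops on a code and input exactly when the code is defined there. -/
theorem halts_run_iff {c : Code} {v : List ℕ} :
    Halts ⟨.run c, v, []⟩ ↔ (c.eval v).Dom := by
  refine ⟨fun ⟨n, h⟩ => ?_, fun h => ?_⟩
  · obtain ⟨r, hr, -⟩ := h.exists_mem_eval
    exact Part.dom_iff_mem.2 ⟨r, hr⟩
  · obtain ⟨r, hr⟩ := Part.dom_iff_mem.1 h
    exact halts_run_of_mem_eval hr ⟨0, rfl⟩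

/-- Some fixed code has an undecidable halting problem. -/
theorem exists_code_not_computablePred :
    ∃ c : Code, ¬ ComputablePred fun x : ℕ => (c.eval [x]).Dom := by
  have hf : Partrec fun x : ℕ => (Denumerable.ofNat Nat.Partrec.Code x).eval 0 :=
    Nat.Partrec.Code.eval_part.comp (Computable.ofNat _) (Computable.const 0)
  obtain ⟨c, hc⟩ := Code.exists_code (Nat.Partrec'.part_iff₁.2 hf)
  refine ⟨c, fun h => ComputablePred.halting_problem 0 ?_⟩
  refine ComputablePred.computable_of_manyOneReducible
    (q := fun x : ℕ => (c.eval [x]).Dom) ⟨Encodable.encode, Computable.encode, fun a => ?_⟩ h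
  have := hc ⟨[Encodable.encode a], rfl⟩
  simp only [List.Vector.head, Denumerable.ofNat_encode] at this
  show _ ↔ (c.eval [Encodable.encode a]).Dom
  rw [this]
  rfl

/-- Satisfaction of a guard, with the store and the letter given as functions. -/
def Holds (σ ℓ : ℕ → ℕ) (g : GuardC) : Prop :=
  ∀ p ∈ g, (p.1 = true → σ p.2.1 = ℓ p.2.2) ∧ (p.1 = false → σ p.2.1 ≠ ℓ p.2.2)

theorem Holds.congr {σ σ' ℓ : ℕ → ℕ} {g : GuardC} (h : ∀ p ∈ g, σ p.2.1 = σ' p.2.1) :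
    Holds σ ℓ g ↔ Holds σ' ℓ g :=
  forall₂_congr fun p hp => by rw [h p hp]

/-- Error patterns for words: forbidden first letters, forbidden letters, forbidden last letters,
forbidden pairs of a letter and some later letter, and forbidden pairs of consecutive letters.
Register `i < 9` stands for component `i` of the earlier letter of a pair, and register `i ≥ 9`
for the constant `i`. -/
structure Errors where
  first : List GuardC
  single : List GuardC
  last : List GuardC
  pair : List GuardC
  succ : List (GuardC × GuardC)

/-- The store in which registers `i < 9` hold the components of a letter. -/
def stored (ℓ : ℕ → ℕ) (i : ℕ) : ℕ := if i < 9 then ℓ i else i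

/-- Some error other than a forbidden first letter occurs in the word. -/
def Errors.Occur (E : Errors) : List (ℕ → ℕ) → Prop
  | [] => False
  | ℓ :: w =>
    (∃ g ∈ E.single, Holds id ℓ g) ∨
    (w = [] ∧ ∃ g ∈ E.last, Holds id ℓ g) ∨
    (∃ g ∈ E.pair, ∃ ℓ' ∈ w, Holds (stored ℓ) ℓ' g) ∨
    (∃ r ∈ E.succ, Holds id ℓ r.1 ∧ ∃ ℓ' ∈ w.head?, Holds (stored ℓ) ℓ' r.2) ∨
    E.Occur w

/-- The action storing a whole letter in the first nine registers. -/
def storeAct : ActionC := (List.range 9).map fun i => (i, i)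

/-- Transitions out of a state that still searches for an error. -/
def Errors.scan (E : Errors) (q : ℕ) : List (ℕ × (GuardC × ActionC) × ℕ) :=
  E.single.map (fun g => (q, (g, []), 2)) ++
  E.last.map (fun g => (q, (g, []), 4)) ++
  E.succ.map (fun r => (q, (r.1, storeAct), 5 + Encodable.encode r.2)) ++
  [(q, ([], storeAct), 3), (q, ([], []), 1)]

/-- Transitions of the automaton that guesses an error. -/
def Errors.delta (E : Errors) : List (ℕ × (GuardC × ActionC) × ℕ) :=
  E.first.map (fun g => (0, (g, []), 2)) ++
  E.scan 0 ++ E.scan 1 ++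
  E.succ.map (fun r => (5 + Encodable.encode r.2, (r.2, []), 2)) ++
  E.pair.map (fun g => (3, (g, []), 2)) ++
  [(3, ([], []), 3), (2, ([], []), 2)]

/-- The automaton accepting the empty word and the words in which an error occurs. -/
def Errors.automaton (E : Errors) (m k : ℕ) : ToplC where
  m := m
  n := 9
  k := k
  q0 := 0
  s0 := List.range m
  delta := E.delta
  F := [0, 2, 4]

/-- A literal referring only to existing registers and components. -/
def LitOk (m : ℕ) (p : Bool × ℕ × ℕ) : Prop := p.2.1 < m ∧ p.2.2 < 9

/-- All guards refer only to existing registers and components. -/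
structure Errors.Ok (E : Errors) (m : ℕ) : Prop where
  first : ∀ g ∈ E.first, ∀ p ∈ g, LitOk m p
  single : ∀ g ∈ E.single, ∀ p ∈ g, LitOk m p
  last : ∀ g ∈ E.last, ∀ p ∈ g, LitOk m p
  pair : ∀ g ∈ E.pair, ∀ p ∈ g, LitOk m p
  succ : ∀ r ∈ E.succ, (∀ p ∈ r.1, LitOk m p) ∧ ∀ p ∈ r.2, LitOk m p

theorem Errors.automaton_wf {E : Errors} {m k : ℕ} (hE : E.Ok m) (hm : 9 ≤ m) (h5 : 5 ≤ k)
    (hk : ∀ r ∈ E.succ, 5 + Encodable.encode r.2 < k) : (E.automaton m k).WF := by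
  have hst : ∀ p ∈ storeAct, p.1 < m ∧ p.2 < 9 := by
    intro p hp
    obtain ⟨i, hi, rfl⟩ := List.mem_map.1 hp
    have := List.mem_range.1 hi
    exact ⟨by omega, this⟩
  have hscan : ∀ q < k, ∀ t ∈ E.scan q, t.1 < k ∧ t.2.2 < k ∧
      (∀ p ∈ t.2.1.1, p.2.1 < m ∧ p.2.2 < 9) ∧ (∀ p ∈ t.2.1.2, p.1 < m ∧ p.2 < 9) := by
    intro q hq t ht
    simp only [Errors.scan, List.mem_append, List.mem_map, List.mem_cons, List.not_mem_nil,
      or_false] at ht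
    rcases ht with ((⟨g, hg, rfl⟩ | ⟨g, hg, rfl⟩) | ⟨r, hr, rfl⟩) | rfl | rfl
    · exact ⟨hq, by show 2 < k; omega, hE.single g hg, by simp⟩
    · exact ⟨hq, by show 4 < k; omega, hE.last g hg, by simp⟩
    · exact ⟨hq, hk r hr, (hE.succ r hr).1, hst⟩
    · exact ⟨hq, by show 3 < k; omega, by simp, hst⟩
    · exact ⟨hq, by show 1 < k; omega, by simp, by simp⟩
  refine ⟨by show 0 < k; omega, List.length_range, ?_, ?_⟩
  · simp only [Errors.automaton, List.mem_cons, List.not_mem_nil, or_false]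
    omega
  · intro t ht
    simp only [Errors.automaton, Errors.delta, List.mem_append, List.mem_map, List.mem_cons,
      List.not_mem_nil, or_false] at ht
    rcases ht with ((((⟨g, hg, rfl⟩ | ht) | ht) | ⟨r, hr, rfl⟩) | ⟨g, hg, rfl⟩) | rfl | rfl
    · exact ⟨by show 0 < k; omega, by show 2 < k; omega, hE.first g hg, by simp⟩
    · exact hscan 0 (by omega) t ht
    · exact hscan 1 (by omega) t ht
    · exact ⟨hk r hr, by show 2 < k; omega, (hE.succ r hr).2, by simp⟩
    · exact ⟨by show 3 < k; omega, by show 2 < k; omega, hE.pair g hg, by simp⟩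
    · exact ⟨by show 3 < k; omega, by show 3 < k; omega, by simp, by simp⟩
    · exact ⟨by show 2 < k; omega, by show 2 < k; omega, by simp, by simp⟩

/-- The automaton has an accepting walk labelled `w` from state `q` and store `s`. -/
def ToplC.Acc (A : ToplC) (q : ℕ) (s : List ℕ) (w : List (List ℕ)) : Prop :=
  ∃ x, A.Reach (q, s) w x ∧ x.1 ∈ A.F

theorem ToplC.acc_nil {A : ToplC} {q : ℕ} {s : List ℕ} : A.Acc q s [] ↔ q ∈ A.F := by
  refine ⟨?_, fun h => ⟨_, .nil _, h⟩⟩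
  rintro ⟨x, h, hx⟩
  cases h
  exact hx

theorem ToplC.acc_cons {A : ToplC} {q : ℕ} {s ℓ : List ℕ} {w : List (List ℕ)} :
    A.Acc q s (ℓ :: w) ↔ ∃ t ∈ A.delta, t.1 = q ∧ Holds (s.getD · 0) (ℓ.getD · 0) t.2.1.1 ∧
      A.Acc t.2.2 (ActionC.run ℓ t.2.1.2 s) w := by
  constructor
  · rintro ⟨x, h, hx⟩
    cases h with
    | cons hs hr =>
      obtain ⟨g, a, hd, hg, ha⟩ := hs
      exact ⟨_, hd, rfl, hg, x, by simpa only [ha] using hr, hx⟩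
  · rintro ⟨⟨q₁, ⟨g, a⟩, q₂⟩, hd, rfl, hg, x, hr, hx⟩
    exact ⟨x, .cons ⟨g, a, hd, hg, rfl⟩ hr, hx⟩

theorem length_run (ℓ : List ℕ) (a : ActionC) (s : List ℕ) :
    (ActionC.run ℓ a s).length = s.length := by
  induction a generalizing s with
  | nil => rfl
  | cons p a ih => simpa [ActionC.run] using ih (s.set p.1 (ℓ.getD p.2 0))

theorem getD_run_storeAct {m i : ℕ} (hm : i < m) (ℓ : List ℕ) :
    (ActionC.run ℓ storeAct (List.range m)).getD i 0 = stored (ℓ.getD · 0) i := by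
  have key : ∀ n, (ActionC.run ℓ ((List.range n).map fun i => (i, i)) (List.range m)).getD i 0 =
      if i < n then ℓ.getD i 0 else i := by
    intro n
    induction n with
    | zero => simp [ActionC.run, hm]
    | succ n ih =>
      have hl := length_run ℓ ((List.range n).map fun i => (i, i)) (List.range m)
      simp only [ActionC.run] at ih hl
      simp only [ActionC.run, List.range_succ, List.map_append, List.foldl_append, List.map_cons,
        List.map_nil, List.foldl_cons, List.foldl_nil]
      rcases eq_or_ne n i with rfl | hne
      · rw [List.getD_eq_getElem _ _ (by rw [List.length_set, hl, List.length_range]; exact hm)]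
        simp
      · rw [List.getD_eq_getElem?_getD, List.getElem?_set_ne hne, ← List.getD_eq_getElem?_getD, ih]
        have : i < n + 1 ↔ i < n := by omega
        simp only [this]
  exact key 9

/-- A letter as a function. -/
def comp (ℓ : List ℕ) (i : ℕ) : ℕ := ℓ.getD i 0

section Automaton

variable {E : Errors} {m k : ℕ}

theorem Errors.mem_scan_fst {q : ℕ} {t : ℕ × (GuardC × ActionC) × ℕ} (h : t ∈ E.scan q) :
    t.1 = q := by
  simp only [Errors.scan, List.mem_append, List.mem_map, List.mem_cons, List.not_mem_nil,
    or_false] at h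
  rcases h with ((⟨g, hg, rfl⟩ | ⟨g, hg, rfl⟩) | ⟨r, hr, rfl⟩) | rfl | rfl <;> rfl

theorem Errors.mem_delta {t : ℕ × (GuardC × ActionC) × ℕ} (h : t ∈ E.delta) :
    (∃ g ∈ E.first, t = (0, (g, []), 2)) ∨ t ∈ E.scan 0 ∨ t ∈ E.scan 1 ∨
    (∃ r ∈ E.succ, t = (5 + Encodable.encode r.2, (r.2, []), 2)) ∨
    (∃ g ∈ E.pair, t = (3, (g, []), 2)) ∨ t = (3, ([], []), 3) ∨ t = (2, ([], []), 2) := by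
  simp only [Errors.delta, List.mem_append, List.mem_map, List.mem_cons, List.not_mem_nil,
    or_false] at h
  rcases h with ((((⟨g, hg, rfl⟩ | ht) | ht) | ⟨r, hr, rfl⟩) | ⟨g, hg, rfl⟩) | rfl | rfl
  · exact .inl ⟨g, hg, rfl⟩
  · exact .inr (.inl ht)
  · exact .inr (.inr (.inl ht))
  · exact .inr (.inr (.inr (.inl ⟨r, hr, rfl⟩)))
  · exact .inr (.inr (.inr (.inr (.inl ⟨g, hg, rfl⟩))))
  · exact .inr (.inr (.inr (.inr (.inr (.inl rfl)))))
  · exact .inr (.inr (.inr (.inr (.inr (.inr rfl)))))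

theorem Errors.acc_two (s : List ℕ) (w : List (List ℕ)) : (E.automaton m k).Acc 2 s w := by
  induction w with
  | nil => exact ToplC.acc_nil.2 (by simp [Errors.automaton])
  | cons ℓ w ih =>
    exact ToplC.acc_cons.2 ⟨(2, ([], []), 2), by simp [Errors.automaton, Errors.delta], rfl,
      by simp [Holds], ih⟩

theorem Errors.acc_four (s : List ℕ) (w : List (List ℕ)) :
    (E.automaton m k).Acc 4 s w ↔ w = [] := by
  cases w with
  | nil => simp [ToplC.acc_nil, Errors.automaton]
  | cons ℓ w =>
    simp only [ToplC.acc_cons, reduceCtorEq, iff_false]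
    rintro ⟨t, ht, h4, -⟩
    rcases Errors.mem_delta ht with
      ⟨g', hg', rfl⟩ | ht | ht | ⟨r, hr, rfl⟩ | ⟨g', hg', rfl⟩ | rfl | rfl
    · simp at h4
    · have := Errors.mem_scan_fst ht; omega
    · have := Errors.mem_scan_fst ht; omega
    · simp only at h4; omega
    · simp at h4
    · simp at h4
    · simp at h4

theorem Errors.acc_three (s : List ℕ) (w : List (List ℕ)) :
    (E.automaton m k).Acc 3 s w ↔
      ∃ g ∈ E.pair, ∃ ℓ ∈ w, Holds (s.getD · 0) (comp ℓ) g := by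
  induction w with
  | nil => simp [ToplC.acc_nil, Errors.automaton]
  | cons ℓ w ih =>
    rw [ToplC.acc_cons]
    constructor
    · rintro ⟨t, ht, h3, hg, ha⟩
      have ht' : (∃ g ∈ E.pair, t = (3, (g, []), 2)) ∨ t = (3, ([], []), 3) := by
        rcases Errors.mem_delta ht with
          ⟨g', hg', rfl⟩ | ht | ht | ⟨r, hr, rfl⟩ | ⟨g', hg', rfl⟩ | rfl | rfl
        · simp at h3
        · have := Errors.mem_scan_fst ht; omega
        · have := Errors.mem_scan_fst ht; omega
        · simp only at h3; omega
        · exact .inl ⟨g', hg', rfl⟩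
        · exact .inr rfl
        · simp at h3
      rcases ht' with ⟨g, hgE, rfl⟩ | rfl
      · exact ⟨g, hgE, ℓ, by simp, hg⟩
      · obtain ⟨g, hgE, ℓ', hℓ, h⟩ := ih.1 ha
        exact ⟨g, hgE, ℓ', by simp [hℓ], h⟩
    · rintro ⟨g, hgE, ℓ', hℓ, h⟩
      rcases List.mem_cons.1 hℓ with rfl | hℓ
      · exact ⟨(3, (g, []), 2), by simp [Errors.automaton, Errors.delta, hgE], rfl, h,
          Errors.acc_two _ _⟩
      · exact ⟨(3, ([], []), 3), by simp [Errors.automaton, Errors.delta], rfl, by simp [Holds],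
          ih.2 ⟨g, hgE, ℓ', hℓ, h⟩⟩

theorem Errors.acc_pending {g : GuardC} (hg : ∃ r ∈ E.succ, r.2 = g) (s : List ℕ)
    (w : List (List ℕ)) :
    (E.automaton m k).Acc (5 + Encodable.encode g) s w ↔
      ∃ ℓ ∈ w.head?, Holds (s.getD · 0) (comp ℓ) g := by
  cases w with
  | nil =>
    simp [ToplC.acc_nil, Errors.automaton]
    omega
  | cons ℓ w =>
    rw [ToplC.acc_cons]
    constructor
    · rintro ⟨t, ht, h5, hh, ha⟩
      have ht' : ∃ r ∈ E.succ, t = (5 + Encodable.encode r.2, (r.2, []), 2) := by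
        rcases Errors.mem_delta ht with
          ⟨g', hg', rfl⟩ | ht | ht | ⟨r, hr, rfl⟩ | ⟨g', hg', rfl⟩ | rfl | rfl
        · simp only at h5; omega
        · have := Errors.mem_scan_fst ht; omega
        · have := Errors.mem_scan_fst ht; omega
        · exact ⟨r, hr, rfl⟩
        · simp only at h5; omega
        · simp only at h5; omega
        · simp only at h5; omega
      obtain ⟨r, hr, rfl⟩ := ht'
      obtain rfl : r.2 = g := Encodable.encode_injective (by simpa using h5)
      exact ⟨ℓ, by simp, hh⟩
    · rintro ⟨ℓ', hℓ, h⟩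
      obtain rfl : ℓ = ℓ' := by simpa using hℓ
      obtain ⟨r, hr, rfl⟩ := hg
      refine ⟨(5 + Encodable.encode r.2, (r.2, []), 2), ?_, rfl, h, Errors.acc_two _ _⟩
      simp only [Errors.automaton, Errors.delta, List.mem_append, List.mem_map]
      exact .inl (.inl (.inr ⟨r, hr, rfl⟩))

theorem holds_range {g : GuardC} (hg : ∀ p ∈ g, LitOk m p) (ℓ : ℕ → ℕ) :
    Holds ((List.range m).getD · 0) ℓ g ↔ Holds id ℓ g :=
  Holds.congr fun p hp => by
    have := (hg p hp).1
    simp [this]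

theorem holds_stored {g : GuardC} (hg : ∀ p ∈ g, LitOk m p) (ℓ : List ℕ) (ℓ' : ℕ → ℕ) :
    Holds ((ActionC.run ℓ storeAct (List.range m)).getD · 0) ℓ' g ↔ Holds (stored (comp ℓ)) ℓ' g :=
  Holds.congr fun p hp => getD_run_storeAct (hg p hp).1 ℓ

theorem Errors.exists_scan (hE : E.Ok m) {ℓ : List ℕ} {w : List (List ℕ)}
    (ih : (E.automaton m k).Acc 1 (List.range m) w ↔ E.Occur (w.map comp)) (q : ℕ) :
    (∃ t ∈ E.scan q, Holds ((List.range m).getD · 0) (ℓ.getD · 0) t.2.1.1 ∧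
      (E.automaton m k).Acc t.2.2 (ActionC.run ℓ t.2.1.2 (List.range m)) w) ↔
    E.Occur ((ℓ :: w).map comp) := by
  have hp : ∀ g ∈ E.pair, ∀ ℓ', Holds ((ActionC.run ℓ storeAct (List.range m)).getD · 0) ℓ' g ↔
      Holds (stored (comp ℓ)) ℓ' g := fun g hg ℓ' => holds_stored (hE.pair g hg) ℓ ℓ'
  simp only [List.map_cons, Errors.Occur]
  constructor
  · rintro ⟨t, ht, hg, ha⟩
    simp only [Errors.scan, List.mem_append, List.mem_map, List.mem_cons, List.not_mem_nil,
      or_false] at ht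
    rcases ht with ((⟨g, hgE, rfl⟩ | ⟨g, hgE, rfl⟩) | ⟨r, hr, rfl⟩) | rfl | rfl
    · exact .inl ⟨g, hgE, (holds_range (hE.single g hgE) _).1 hg⟩
    · have := (Errors.acc_four _ _).1 ha
      exact .inr (.inl ⟨by simp [this], g, hgE, (holds_range (hE.last g hgE) _).1 hg⟩)
    · obtain ⟨ℓ', hℓ, h⟩ := (Errors.acc_pending ⟨r, hr, rfl⟩ _ _).1 ha
      refine .inr (.inr (.inr (.inl
        ⟨r, hr, (holds_range (hE.succ r hr).1 _).1 hg, comp ℓ', ?_, ?_⟩)))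
      · simpa using ⟨ℓ', hℓ, rfl⟩
      · exact (holds_stored (hE.succ r hr).2 _ _).1 h
    · obtain ⟨g, hgE, ℓ', hℓ, h⟩ := (Errors.acc_three _ _).1 ha
      exact .inr (.inr (.inl ⟨g, hgE, comp ℓ', List.mem_map_of_mem hℓ,
        (holds_stored (hE.pair g hgE) _ _).1 h⟩))
    · exact .inr (.inr (.inr (.inr (ih.1 ha))))
  · rintro (⟨g, hgE, h⟩ | ⟨hw, g, hgE, h⟩ | ⟨g, hgE, ℓ', hℓ, h⟩ | ⟨r, hr, h, ℓ', hℓ, h'⟩ | h)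
    · exact ⟨(q, (g, []), 2), by simp [Errors.scan, hgE],
        (holds_range (hE.single g hgE) _).2 h, Errors.acc_two _ _⟩
    · exact ⟨(q, (g, []), 4), by simp [Errors.scan, hgE],
        (holds_range (hE.last g hgE) _).2 h, (Errors.acc_four _ _).2 (by simpa using hw)⟩
    · obtain ⟨ℓ', hmem, rfl⟩ := List.mem_map.1 hℓ
      exact ⟨(q, ([], storeAct), 3), by simp [Errors.scan], by simp [Holds],
        (Errors.acc_three _ _).2 ⟨g, hgE, ℓ', hmem, (holds_stored (hE.pair g hgE) _ _).2 h⟩⟩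
    · obtain ⟨ℓ', hmem, rfl⟩ : ∃ a, w.head? = some a ∧ comp a = ℓ' := by simpa using hℓ
      refine ⟨(q, (r.1, storeAct), 5 + Encodable.encode r.2), ?_,
        (holds_range (hE.succ r hr).1 _).2 h, (Errors.acc_pending ⟨r, hr, rfl⟩ _ _).2
          ⟨ℓ', hmem, (holds_stored (hE.succ r hr).2 _ _).2 h'⟩⟩
      simp only [Errors.scan, List.mem_append, List.mem_map]
      exact .inl (.inr ⟨r, hr, rfl⟩)
    · exact ⟨(q, ([], []), 1), by simp [Errors.scan], by simp [Holds], ih.2 h⟩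

theorem Errors.acc_one (hE : E.Ok m) (w : List (List ℕ)) :
    (E.automaton m k).Acc 1 (List.range m) w ↔ E.Occur (w.map comp) := by
  induction w with
  | nil => simp [ToplC.acc_nil, Errors.automaton, Errors.Occur]
  | cons ℓ w ih =>
    rw [ToplC.acc_cons, ← Errors.exists_scan hE ih 1]
    have hd : ∀ t : ℕ × (GuardC × ActionC) × ℕ,
        t ∈ (E.automaton m k).delta ∧ t.1 = 1 ↔ t ∈ E.scan 1 := by
      intro t
      refine ⟨fun ⟨ht, h1⟩ => ?_, fun ht => ⟨?_, Errors.mem_scan_fst ht⟩⟩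
      · have h0 : t ∉ E.scan 0 := fun h => by simp [Errors.mem_scan_fst h] at h1
        rcases Errors.mem_delta ht with
          ⟨g', hg', rfl⟩ | ht | ht | ⟨r, hr, rfl⟩ | ⟨g', hg', rfl⟩ | rfl | rfl
        · simp at h1
        · exact absurd ht h0
        · exact ht
        · simp only at h1; omega
        · simp at h1
        · simp at h1
        · simp at h1
      · simp [Errors.automaton, Errors.delta, ht]
    simp only [← hd, and_assoc]

theorem Errors.acc_zero (hE : E.Ok m) (ℓ : List ℕ) (w : List (List ℕ)) :
    (E.automaton m k).Acc 0 (List.range m) (ℓ :: w) ↔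
      (∃ g ∈ E.first, Holds id (comp ℓ) g) ∨ E.Occur ((ℓ :: w).map comp) := by
  rw [ToplC.acc_cons, ← Errors.exists_scan hE (Errors.acc_one (k := k) hE w) 0]
  constructor
  · rintro ⟨t, ht, h0, hg, ha⟩
    have ht' : (∃ g ∈ E.first, t = (0, (g, []), 2)) ∨ t ∈ E.scan 0 := by
      have h1 : t ∉ E.scan 1 := fun h => by simp [Errors.mem_scan_fst h] at h0
      rcases Errors.mem_delta ht with
        ⟨g', hg', rfl⟩ | ht | ht | ⟨r, hr, rfl⟩ | ⟨g', hg', rfl⟩ | rfl | rfl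
      · exact .inl ⟨g', hg', rfl⟩
      · exact .inr ht
      · exact absurd ht h1
      · simp only at h0; omega
      · simp at h0
      · simp at h0
      · simp at h0
    rcases ht' with ⟨g, hgE, rfl⟩ | ht'
    · exact .inl ⟨g, hgE, (holds_range (hE.first g hgE) _).1 hg⟩
    · exact .inr ⟨t, ht', hg, ha⟩
  · rintro (⟨g, hgE, h⟩ | ⟨t, ht, hg, ha⟩)
    · exact ⟨(0, (g, []), 2), by simp [Errors.automaton, Errors.delta, hgE], rfl,
        (holds_range (hE.first g hgE) _).2 h, Errors.acc_two _ _⟩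
    · exact ⟨t, by simp [Errors.automaton, Errors.delta, ht], Errors.mem_scan_fst ht, hg, ha⟩

/-- The automaton is universal exactly when an error occurs in every nonempty word. -/
theorem Errors.lang_automaton_eq (hE : E.Ok m) :
    (E.automaton m k).Lang = fullLang (E.automaton m k).n ↔
      ∀ ℓ w, (∀ ℓ' ∈ ℓ :: w, List.length ℓ' = 9) →
        (∃ g ∈ E.first, Holds id (comp ℓ) g) ∨ E.Occur ((ℓ :: w).map comp) := by
  constructor
  · intro h ℓ w hw
    have : (ℓ :: w) ∈ (E.automaton m k).Lang := by rw [h]; exact hw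
    exact (Errors.acc_zero hE ℓ w).1 this.2
  · intro h
    ext w
    refine ⟨fun hw => hw.1, fun hw => ⟨hw, ?_⟩⟩
    cases w with
    | nil => exact ToplC.acc_nil.2 (by simp [Errors.automaton])
    | cons ℓ w => exact (Errors.acc_zero hE ℓ w).2 (h ℓ w hw)

end Automaton

/-- An injective numbering of codes. -/
def num : Code → ℕ
  | .zero' => 0
  | .succ => 1
  | .tail => 2
  | .cons f g => 4 * Nat.pair (num f) (num g) + 3
  | .comp f g => 4 * Nat.pair (num f) (num g) + 4
  | .case f g => 4 * Nat.pair (num f) (num g) + 5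
  | .fix f => 4 * num f + 6

theorem num_injective : Function.Injective num := by
  have pair_inj : ∀ {a b c d : ℕ}, 4 * Nat.pair a b = 4 * Nat.pair c d → a = c ∧ b = d :=
    fun h => Nat.pair_eq_pair.1 (by omega)
  intro c
  induction c with
  | zero' | succ | tail =>
    intro d h
    cases d <;> simp only [num] at h <;> first | rfl | omega
  | cons f g ihf ihg | comp f g ihf ihg | case f g ihf ihg =>
    intro d h
    cases d <;> simp only [num] at h <;> first | omega | skip
    obtain ⟨hf, hg⟩ := pair_inj (Nat.add_right_cancel h)
    rw [ihf hf, ihg hg]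
  | fix f ih =>
    intro d h
    cases d <;> simp only [num] at h <;> first | omega | skip
    rw [ih (Nat.eq_of_mul_eq_mul_left four_pos (Nat.add_right_cancel h))]

/-- The number of a control. -/
def Ctl.num : Ctl → ℕ
  | .ret => 0
  | .run c => Topl.num c + 1

theorem Ctl.num_inj {a b : Ctl} : a.num = b.num ↔ a = b := by
  refine ⟨fun h => ?_, fun h => h ▸ rfl⟩
  cases a <;> cases b <;> simp only [Ctl.num] at h <;> first | rfl | omega | skip
  exact congrArg _ (num_injective (Nat.add_right_cancel h))

/-- The positive number of a frame tag. -/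
def Tag.num : Tag → ℕ
  | .snd => 1
  | .fst f => 3 * Topl.num f + 2
  | .cmp f => 3 * Topl.num f + 3
  | .fx f => 3 * Topl.num f + 4

theorem Tag.num_pos (a : Tag) : 0 < a.num := by
  cases a <;> simp [Tag.num]

theorem Tag.num_inj {a b : Tag} : a.num = b.num ↔ a = b := by
  refine ⟨fun h => ?_, fun h => h ▸ rfl⟩
  cases a <;> cases b <;> simp only [Tag.num] at h <;> first | rfl | omega | skip
  all_goals
    exact congrArg _ (num_injective (Nat.eq_of_mul_eq_mul_left three_pos (Nat.add_right_cancel h)))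

/-- All subcodes of a code. -/
def subs : Code → List Code
  | .zero' => [.zero']
  | .succ => [.succ]
  | .tail => [.tail]
  | .cons f g => .cons f g :: (subs f ++ subs g)
  | .comp f g => .comp f g :: (subs f ++ subs g)
  | .case f g => .case f g :: (subs f ++ subs g)
  | .fix f => .fix f :: subs f

theorem mem_subs_self (c : Code) : c ∈ subs c := by
  cases c <;> simp [subs]

theorem subs_trans {c d e : Code} (h : e ∈ subs d) (hd : d ∈ subs c) : e ∈ subs c := by
  induction c with
  | zero' | succ | tail =>
    simp only [subs, List.mem_singleton] at hd
    subst hd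
    exact h
  | cons f g ihf ihg | comp f g ihf ihg | case f g ihf ihg =>
    simp only [subs, List.mem_cons, List.mem_append] at hd ⊢
    rcases hd with rfl | hd | hd
    · simpa [subs] using h
    · exact .inr (.inl (ihf hd))
    · exact .inr (.inr (ihg hd))
  | fix f ih =>
    simp only [subs, List.mem_cons] at hd ⊢
    rcases hd with rfl | hd
    · simpa [subs] using h
    · exact .inr (ih hd)

/-- The control is the given one, as a literal. -/
def Ctl.here (q : Ctl) : Bool × ℕ × ℕ := (true, 9 + q.num, 0)

/-- The control differs from the given one, as a literal. -/
def Ctl.away (q : Ctl) : Bool × ℕ × ℕ := (false, 9 + q.num, 0)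

/-- The topmost frame has the given tag, as a literal. -/
def Tag.top (t : Tag) : Bool × ℕ × ℕ := (true, 9 + t.num, 6)

/-- Violations of the requirement that a frame be pushed. -/
def Tag.push (t : Tag) (l r : ℕ) : GuardC := [(false, 9 + t.num, 6), (false, l, 7), (false, r, 8)]

/-- Transition rules for running a code: a condition on a letter, and the literals
that the next letter has to violate. -/
def codeRules : Code → List (GuardC × GuardC)
  | .zero' => [([Ctl.here (.run .zero')],
      [Ctl.away .ret, (false, 9, 2), (false, 1, 3), (false, 5, 5)])]
  | .succ => [([Ctl.here (.run .succ)],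
      [Ctl.away .ret, (true, 9, 2), (false, 2, 4), (false, 9, 3), (false, 5, 5)])]
  | .tail => [([Ctl.here (.run .tail)], [Ctl.away .ret, (false, 3, 1), (false, 5, 5)])]
  | .cons f g => [([Ctl.here (.run (.cons f g))],
      Ctl.away (.run g) :: (false, 1, 1) :: Tag.push (.fst f) 1 5)]
  | .comp f g => [([Ctl.here (.run (.comp f g))],
      Ctl.away (.run g) :: (false, 1, 1) :: Tag.push (.cmp f) 1 5)]
  | .case f g => [
      ([Ctl.here (.run (.case f g)), (true, 9, 2)],
        [Ctl.away (.run f), (false, 3, 1), (false, 5, 5)]),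
      ([Ctl.here (.run (.case f g)), (false, 9, 2)],
        [Ctl.away (.run g), (false, 4, 2), (false, 3, 3), (false, 5, 5)])]
  | .fix f => [([Ctl.here (.run (.fix f))],
      Ctl.away (.run f) :: (false, 1, 1) :: Tag.push (.fx f) 1 5)]

/-- Transition rules for returning to a frame that mentions a given code. -/
def frameRules (f : Code) : List (GuardC × GuardC) := [
  ([Ctl.here .ret, Tag.top (.fst f)],
    Ctl.away (.run f) :: (false, 7, 1) :: Tag.push .snd 1 8),
  ([Ctl.here .ret, Tag.top (.cmp f)], [Ctl.away (.run f), (false, 1, 1), (false, 8, 5)]),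
  ([Ctl.here .ret, Tag.top (.fx f), (true, 9, 2)],
    [Ctl.away .ret, (false, 3, 1), (false, 8, 5)]),
  ([Ctl.here .ret, Tag.top (.fx f), (false, 9, 2)],
    [Ctl.away (.run f), (false, 3, 1), (false, 5, 5)])]

/-- All transition rules needed for running a given code. -/
def rules (c : Code) : List (GuardC × GuardC) :=
  ([Ctl.here .ret, Tag.top .snd],
    [Ctl.away .ret, (false, 2, 2), (false, 7, 3), (false, 8, 5)]) ::
  (subs c).flatMap fun d => codeRules d ++ frameRules d

/-- The possible errors in an encoding of a run of `c` on input `[x]`. Component 0 of a letter is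
the control; components 1 to 4 are the value, its head, its tail and the predecessor of its head;
components 5 to 8 are the stack, the tag and the list of its topmost frame, and the rest. -/
def errors (c : Code) (x : ℕ) : Errors where
  first := [[(false, 9 + (Ctl.run c).num, 0)], [(false, 9, 5)], [(false, 9, 3)],
    [(false, 9 + x, 2)]]
  single := [(true, 9, 1), (false, 9, 2)] :: [(true, 9, 1), (false, 9, 3)] ::
    (List.range x).map fun i => [(true, 10 + i, 2), (false, 9 + i, 4)]
  last := [[(false, 9, 0)], [(false, 9, 6)]]
  pair := [(1, 2), (1, 3), (2, 4), (5, 6), (5, 7), (5, 8)].map fun p =>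
    [(true, p.1, p.1), (false, p.2, p.2)]
  succ := (rules c).flatMap fun r => r.2.map fun p => (r.1, [p])

theorem errors_ok (c : Code) : ∃ B, 9 ≤ B ∧ ∀ x, (errors c x).Ok (B + x) := by
  obtain ⟨B, hB⟩ : ∃ B, ∀ i ∈ (rules c).flatMap fun r => (r.1 ++ r.2).map fun p => p.2.1, i < B :=
    ⟨_, fun i hi => Nat.lt_succ_of_le (List.le_sum_of_mem hi)⟩
  have hreg : ∀ r ∈ rules c, ∀ p ∈ r.1 ++ r.2, p.2.1 < B := fun r hr p hp =>
    hB _ (List.mem_flatMap.2 ⟨r, hr, List.mem_map.2 ⟨p, hp, rfl⟩⟩)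
  have hcomp : ∀ r ∈ rules c, ∀ p ∈ r.1 ++ r.2, p.2.2 < 9 := by
    intro r hr
    simp only [rules, List.mem_cons, List.mem_flatMap, List.mem_append] at hr
    rcases hr with rfl | ⟨d, -, hr | hr⟩
    · simp [Ctl.here, Ctl.away, Tag.top]
    · cases d <;> simp only [codeRules, List.mem_cons, List.not_mem_nil, or_false] at hr
      case case => rcases hr with rfl | rfl <;> simp [Ctl.here, Ctl.away]
      all_goals subst hr; simp [Ctl.here, Ctl.away, Tag.push]
    · simp only [frameRules, List.mem_cons, List.not_mem_nil, or_false] at hr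
      rcases hr with rfl | rfl | rfl | rfl <;> simp [Ctl.here, Ctl.away, Tag.push, Tag.top]
  refine ⟨B + (10 + (Ctl.run c).num), by omega, fun x => ⟨?_, ?_, ?_, ?_, ?_⟩⟩
  · simp [errors, LitOk]
    omega
  · simp [errors, LitOk]
    exact ⟨by omega, fun i hi => by omega⟩
  · simp [errors, LitOk]
    omega
  · simp [errors, LitOk]
    omega
  · intro r hr
    simp only [errors, List.mem_flatMap, List.mem_map] at hr
    obtain ⟨r, hr, p, hp, rfl⟩ := hr
    have key : ∀ p ∈ r.1 ++ r.2, LitOk (B + (10 + (Ctl.run c).num) + x) p := fun p hp =>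
      ⟨by have := hreg r hr p hp; omega, hcomp r hr p hp⟩
    refine ⟨fun p hp => key p (by simp [hp]), fun q hq => ?_⟩
    obtain rfl := List.mem_singleton.1 hq
    exact key _ (by simp [hp])

section Holds

variable {σ ℓ : ℕ → ℕ} {i j : ℕ} {g : GuardC}

theorem holds_nil : Holds σ ℓ [] := by simp [Holds]

theorem holds_eq : Holds σ ℓ ((true, i, j) :: g) ↔ σ i = ℓ j ∧ Holds σ ℓ g := by
  simp [Holds]

theorem holds_ne : Holds σ ℓ ((false, i, j) :: g) ↔ σ i ≠ ℓ j ∧ Holds σ ℓ g := by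
  simp [Holds]

theorem stored_const (n : ℕ) : stored ℓ (9 + n) = 9 + n := by simp [stored]

theorem stored_nine : stored ℓ 9 = 9 := rfl

theorem stored_comp (hi : i < 9) : stored ℓ i = ℓ i := by simp [stored, hi]

end Holds

/-- A pair of consecutive letters obeys some transition rules. -/
def Obeys (R : List (GuardC × GuardC)) (ℓ ℓ' : ℕ → ℕ) : Prop :=
  ∀ r ∈ R, Holds id ℓ r.1 → ∀ p ∈ r.2, ¬ Holds (stored ℓ) ℓ' [p]

theorem exists_succ_iff {c : Code} {x : ℕ} {ℓ ℓ' : ℕ → ℕ} :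
    (∃ r ∈ (errors c x).succ, Holds id ℓ r.1 ∧ Holds (stored ℓ) ℓ' r.2) ↔
      ¬ Obeys (rules c) ℓ ℓ' := by
  simp only [errors, Obeys, List.mem_flatMap, List.mem_map]
  push Not
  constructor
  · rintro ⟨_, ⟨r, hr, p, hp, rfl⟩, h, h'⟩
    exact ⟨r, hr, h, p, hp, h'⟩
  · rintro ⟨r, hr, h, p, hp, h'⟩
    exact ⟨_, ⟨r, hr, p, hp, rfl⟩, h, h'⟩

/-- The stack with tags replaced by their numbers. -/
def Cfg.frames (a : Cfg) : List (ℕ × List ℕ) := a.stk.map fun t => (t.1.num, t.2)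

/-- The letter encoding a configuration. -/
def Cfg.letter (a : Cfg) : List ℕ :=
  [9 + a.ctl.num, 9 + Encodable.encode a.val, 9 + a.val.headI, 9 + Encodable.encode a.val.tail,
    9 + (a.val.headI - 1), 9 + Encodable.encode a.frames, 9 + a.frames.headI.1,
    9 + Encodable.encode a.frames.headI.2, 9 + Encodable.encode a.frames.tail]

section Letter

variable {a : Cfg} {g : GuardC}

theorem holds_here {q : Ctl} :
    Holds id (comp a.letter) (q.here :: g) ↔ a.ctl = q ∧ Holds id (comp a.letter) g := by
  simp only [Ctl.here, holds_eq, comp, Cfg.letter]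
  simp [Ctl.num_inj, eq_comm]

theorem holds_top {t : Tag} : Holds id (comp a.letter) (t.top :: g) ↔
    (∃ l k, a.stk = (t, l) :: k) ∧ Holds id (comp a.letter) g := by
  simp only [Tag.top, holds_eq, comp, Cfg.letter, Cfg.frames]
  rcases a.stk with _ | ⟨⟨t', l⟩, k⟩
  · simp [t.num_pos.ne', default]
  · simp [Tag.num_inj, eq_comm]

theorem holds_zero :
    Holds id (comp a.letter) ((true, 9, 2) :: g) ↔
      a.val.headI = 0 ∧ Holds id (comp a.letter) g := by
  simp [holds_eq, comp, Cfg.letter]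

theorem holds_nonzero :
    Holds id (comp a.letter) ((false, 9, 2) :: g) ↔
      a.val.headI ≠ 0 ∧ Holds id (comp a.letter) g := by
  simp [holds_ne, comp, Cfg.letter]

end Letter

theorem obeys_letter {a b : Cfg} (h : a.next = some b) (c : Code) :
    Obeys (rules c) (comp a.letter) (comp b.letter) := by
  obtain ⟨q, v, k⟩ := a
  intro r hr
  simp only [rules, List.mem_cons, List.mem_flatMap, List.mem_append] at hr
  rcases hr with rfl | ⟨d, -, hr | hr⟩
  · simp only [holds_here, holds_top, holds_nil]
    rintro ⟨rfl, ⟨l, k, rfl⟩, -⟩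
    simp only [Cfg.next, Option.some.injEq] at h
    subst h
    simp [Ctl.away, holds_ne, stored, comp, Cfg.letter, Cfg.frames, holds_nil]
  · cases d <;> simp only [codeRules, List.mem_cons, List.not_mem_nil, or_false] at hr
    case case =>
      rcases hr with rfl | rfl <;>
      simp only [holds_here, holds_zero, holds_nonzero, holds_nil] <;>
      rintro ⟨rfl, h0, -⟩ <;>
      simp only [Cfg.next, h0, if_true, if_false, Option.some.injEq] at h <;>
      subst h <;>
      simp [Ctl.away, holds_ne, stored, comp, Cfg.letter, Cfg.frames, holds_nil]
    all_goals
      subst hr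
      simp only [holds_here, holds_nil]
      rintro ⟨rfl, -⟩
      simp only [Cfg.next, Option.some.injEq] at h
      subst h
      simp [Ctl.away, Tag.push, holds_ne, holds_eq, stored, comp, Cfg.letter, Cfg.frames, holds_nil]
  · simp only [frameRules, List.mem_cons, List.not_mem_nil, or_false] at hr
    rcases hr with rfl | rfl | rfl | rfl <;>
    simp only [holds_here, holds_top, holds_zero, holds_nonzero, holds_nil]
    · rintro ⟨rfl, ⟨l, k, rfl⟩, -⟩
      simp only [Cfg.next, Option.some.injEq] at h
      subst h
      simp [Ctl.away, Tag.push, holds_ne, stored, comp, Cfg.letter, Cfg.frames, holds_nil]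
    · rintro ⟨rfl, ⟨l, k, rfl⟩, -⟩
      simp only [Cfg.next, Option.some.injEq] at h
      subst h
      simp [Ctl.away, holds_ne, stored, comp, Cfg.letter, Cfg.frames, holds_nil]
    · rintro ⟨rfl, ⟨l, k, rfl⟩, h0, -⟩
      simp only [Cfg.next, h0, if_true, Option.some.injEq] at h
      subst h
      simp [Ctl.away, holds_ne, stored, comp, Cfg.letter, Cfg.frames, holds_nil]
    · rintro ⟨rfl, ⟨l, k, rfl⟩, h0, -⟩
      simp only [Cfg.next, h0, if_false, Option.some.injEq] at h
      subst h
      simp [Ctl.away, holds_ne, stored, comp, Cfg.letter, Cfg.frames, holds_nil]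

theorem not_single_letter (a : Cfg) (c : Code) (x : ℕ) :
    ¬ ∃ g ∈ (errors c x).single, Holds id (comp a.letter) g := by
  obtain ⟨q, v, k⟩ := a
  cases v <;> cases k <;>
    simp [errors, holds_eq, holds_ne, holds_nil, comp, Cfg.letter, Cfg.frames, default] <;> omega

theorem not_pair_letter (a b : Cfg) (c : Code) (x : ℕ) :
    ∀ g ∈ (errors c x).pair, ¬ Holds (stored (comp a.letter)) (comp b.letter) g := by
  simp +contextual [errors, holds_eq, holds_ne, holds_nil, stored, comp, Cfg.letter]

theorem not_last_letter {a : Cfg} (h : a.next = none) (c : Code) (x : ℕ) :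
    ¬ ∃ g ∈ (errors c x).last, Holds id (comp a.letter) g := by
  have : a.ctl = .ret ∧ a.stk = [] := by
    unfold Cfg.next at h
    split at h <;> first | exact ⟨rfl, rfl⟩ | (split_ifs at h) | simp at h
  simp [errors, holds_ne, holds_nil, comp, Cfg.letter, Cfg.frames, this, Ctl.num, default]

theorem HaltsIn.exists_not_occur (c : Code) (x : ℕ) : ∀ {n : ℕ} {a : Cfg}, HaltsIn n a →
    ∃ w : List Cfg, ¬ (errors c x).Occur ((a :: w).map fun b => comp b.letter)
  | 0, a, h => ⟨[], by
      simp only [List.map_cons, List.map_nil, Errors.Occur]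
      rintro (h' | ⟨-, h'⟩ | ⟨g, hg, ℓ, hℓ, -⟩ | ⟨r, hr, -, ℓ, hℓ, -⟩ | h')
      · exact not_single_letter a c x h'
      · exact not_last_letter h c x h'
      · simp at hℓ
      · simp at hℓ
      · exact h'⟩
  | n + 1, a, ⟨b, hb, h⟩ => by
      obtain ⟨w, hw⟩ := HaltsIn.exists_not_occur c x h
      refine ⟨b :: w, ?_⟩
      rw [List.map_cons, Errors.Occur]
      rintro (h' | ⟨h', -⟩ | ⟨g, hg, ℓ, hℓ, h'⟩ | ⟨r, hr, h₁, ℓ, hℓ, h₂⟩ | h')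
      · exact not_single_letter a c x h'
      · simp at h'
      · obtain ⟨b', -, rfl⟩ := List.mem_map.1 hℓ
        exact not_pair_letter a b' c x g hg h'
      · obtain rfl : comp b.letter = ℓ := by simpa using hℓ
        exact exists_succ_iff.1 ⟨r, hr, h₁, h₂⟩ (obeys_letter hb c)
      · exact hw h'

theorem Errors.occur_of_single {E : Errors} {w : List (ℕ → ℕ)} {ℓ : ℕ → ℕ} (hℓ : ℓ ∈ w)
    (h : ∃ g ∈ E.single, Holds id ℓ g) : E.Occur w := by
  induction w with
  | nil => simp at hℓ
  | cons ℓ' w ih =>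
    rcases List.mem_cons.1 hℓ with rfl | hℓ
    · exact .inl h
    · exact .inr (.inr (.inr (.inr (ih hℓ))))

theorem Errors.occur_of_pair {E : Errors} {w : List (ℕ → ℕ)} {ℓ ℓ' : ℕ → ℕ} (hℓ : ℓ ∈ w)
    (hℓ' : ℓ' ∈ w) {i j : ℕ} (hi : i < 9) (hj : j < 9)
    (hE : [(true, i, i), (false, j, j)] ∈ E.pair) (h : ℓ i = ℓ' i) (hne : ℓ j ≠ ℓ' j) :
    E.Occur w := by
  induction w with
  | nil => simp at hℓ
  | cons ℓ₀ w ih =>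
    rcases List.mem_cons.1 hℓ with rfl | hm <;> rcases List.mem_cons.1 hℓ' with rfl | hm'
    · exact absurd rfl hne
    · refine .inr (.inr (.inl ⟨_, hE, ℓ', hm', ?_⟩))
      simp [holds_eq, holds_ne, holds_nil, stored_comp, hi, hj, h, hne]
    · refine .inr (.inr (.inl ⟨_, hE, ℓ, hm, ?_⟩))
      simp [holds_eq, holds_ne, holds_nil, stored_comp, hi, hj, h, hne.symm]
    · exact .inr (.inr (.inr (.inr (ih hm hm'))))

/-- The numbers denoted by values, according to a collection of letters. -/
inductive DenNat (x : ℕ) (W : List (ℕ → ℕ)) : ℕ → ℕ → Prop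
  | small (i) : i ≤ x → DenNat x W (9 + i) i
  | succ {ℓ n} : ℓ ∈ W → ℓ 2 ≠ 9 → DenNat x W (ℓ 4) n → DenNat x W (ℓ 2) (n + 1)

/-- The lists denoted by values, according to a collection of letters. -/
inductive DenList (x : ℕ) (W : List (ℕ → ℕ)) : ℕ → List ℕ → Prop
  | nil : DenList x W 9 []
  | cons {ℓ n l} : ℓ ∈ W → DenNat x W (ℓ 2) n → DenList x W (ℓ 3) l → DenList x W (ℓ 1) (n :: l)

/-- Only subcodes of a given code occur in the control. -/
def Ctl.Sub (c : Code) : Ctl → Prop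
  | .ret => True
  | .run d => d ∈ subs c

/-- Only subcodes of a given code occur in the tag. -/
def Tag.Sub (c : Code) : Tag → Prop
  | .snd => True
  | .fst d => d ∈ subs c
  | .cmp d => d ∈ subs c
  | .fx d => d ∈ subs c

/-- The stacks denoted by values, according to a collection of letters. -/
inductive DenStk (c : Code) (x : ℕ) (W : List (ℕ → ℕ)) : ℕ → List (Tag × List ℕ) → Prop
  | nil : DenStk c x W 9 []
  | cons {ℓ t l k} : ℓ ∈ W → t.Sub c → ℓ 6 = 9 + t.num → DenList x W (ℓ 7) l →
      DenStk c x W (ℓ 8) k → DenStk c x W (ℓ 5) ((t, l) :: k)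

/-- A letter denotes a configuration, according to a collection of letters. -/
structure Rep (c : Code) (x : ℕ) (W : List (ℕ → ℕ)) (ℓ : ℕ → ℕ) (a : Cfg) : Prop where
  sub : a.ctl.Sub c
  ctl : ℓ 0 = 9 + a.ctl.num
  val : DenList x W (ℓ 1) a.val
  stk : DenStk c x W (ℓ 5) a.stk

section Sound

variable {c : Code} {x : ℕ} {W : List (ℕ → ℕ)} {ℓ ℓ' : ℕ → ℕ}

theorem DenNat.zero (x : ℕ) (W : List (ℕ → ℕ)) : DenNat x W 9 0 := .small 0 x.zero_le

theorem DenNat.eq_nine_iff {u n : ℕ} (h : DenNat x W u n) : u = 9 ↔ n = 0 := by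
  cases h with
  | small i hi => omega
  | succ hm hne _ => simp [hne]

theorem DenNat.pred (hW : ¬ (errors c x).Occur W) (hℓ : ℓ ∈ W) {n : ℕ}
    (h : DenNat x W (ℓ 2) n) (hn : n ≠ 0) : DenNat x W (ℓ 4) (n - 1) := by
  generalize e : ℓ 2 = u at h
  cases h with
  | small _ hi =>
    obtain ⟨i, rfl⟩ := Nat.exists_eq_succ_of_ne_zero hn
    have : ℓ 4 = 9 + i := by
      by_contra hne
      refine hW (Errors.occur_of_single hℓ ⟨[(true, 10 + i, 2), (false, 9 + i, 4)], ?_, ?_⟩)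
      · simp only [errors, List.mem_cons, List.mem_map, List.mem_range]
        exact .inr (.inr ⟨i, hi, rfl⟩)
      · simp only [holds_eq, holds_ne, holds_nil, id]
        exact ⟨by omega, fun h => hne h.symm, trivial⟩
    rw [this]
    exact .small _ (by omega)
  | succ hm hne h =>
    rename_i ℓ₀ n
    have : ℓ 4 = ℓ₀ 4 := by
      by_contra hne
      exact hW (Errors.occur_of_pair hℓ hm (by simp) (by simp) (by simp [errors]) e hne)
    rw [this]
    exact h

theorem DenList.headI_tail (hW : ¬ (errors c x).Occur W) (hℓ : ℓ ∈ W) {l : List ℕ}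
    (h : DenList x W (ℓ 1) l) : DenNat x W (ℓ 2) l.headI ∧ DenList x W (ℓ 3) l.tail := by
  generalize e : ℓ 1 = u at h
  cases h with
  | nil =>
    have h2 : 9 = ℓ 2 := by
      by_contra hne
      exact hW (Errors.occur_of_single hℓ
        ⟨_, .head _, holds_eq.2 ⟨e.symm, holds_ne.2 ⟨hne, holds_nil⟩⟩⟩)
    have h3 : 9 = ℓ 3 := by
      by_contra hne
      exact hW (Errors.occur_of_single hℓ
        ⟨_, .tail _ (.head _), holds_eq.2 ⟨e.symm, holds_ne.2 ⟨hne, holds_nil⟩⟩⟩)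
    rw [← h2, ← h3]
    exact ⟨.zero x W, .nil⟩
  | cons hm hn hl =>
    rename_i ℓ₀ n l
    have h2 : ℓ 2 = ℓ₀ 2 := by
      by_contra hne
      exact hW (Errors.occur_of_pair hℓ hm (by simp) (by simp) (by simp [errors]) e hne)
    have h3 : ℓ 3 = ℓ₀ 3 := by
      by_contra hne
      exact hW (Errors.occur_of_pair hℓ hm (by simp) (by simp) (by simp [errors]) e hne)
    rw [h2, h3]
    exact ⟨hn, hl⟩

theorem DenStk.head (hW : ¬ (errors c x).Occur W) (hℓ : ℓ ∈ W) {t : Tag} {l : List ℕ}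
    {k : List (Tag × List ℕ)} (h : DenStk c x W (ℓ 5) ((t, l) :: k)) :
    t.Sub c ∧ ℓ 6 = 9 + t.num ∧ DenList x W (ℓ 7) l ∧ DenStk c x W (ℓ 8) k := by
  generalize e : ℓ 5 = u at h
  cases h with
  | cons hm ht h6 h7 h8 =>
    rename_i ℓ₀
    have key : ∀ j < 9, [(true, 5, 5), (false, j, j)] ∈ (errors c x).pair → ℓ j = ℓ₀ j := by
      intro j hj hp
      by_contra hne
      exact hW (Errors.occur_of_pair hℓ hm (by simp) hj hp e hne)
    rw [key 6 (by simp) (by simp [errors]), key 7 (by simp) (by simp [errors]),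
      key 8 (by simp) (by simp [errors])]
    exact ⟨ht, h6, h7, h8⟩

theorem Rep.next (hW : ¬ (errors c x).Occur W) (hℓ : ℓ ∈ W) (hℓ' : ℓ' ∈ W)
    (hob : Obeys (rules c) ℓ ℓ') {a b : Cfg} (ha : Rep c x W ℓ a) (h : a.next = some b) :
    Rep c x W ℓ' b := by
  obtain ⟨q, v, k⟩ := a
  obtain ⟨hs, hq, hv, hk⟩ := ha
  simp only at hs hq hv hk
  have hv' := hv.headI_tail hW hℓ
  have hcode : ∀ d ∈ subs c, ∀ r ∈ codeRules d, Holds id ℓ r.1 →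
      ∀ p ∈ r.2, ¬ Holds (stored ℓ) ℓ' [p] := fun d hd r hr =>
    hob r (by
      simp only [rules, List.mem_cons, List.mem_flatMap, List.mem_append]
      exact .inr ⟨d, hd, .inl hr⟩)
  have hframe : ∀ d ∈ subs c, ∀ r ∈ frameRules d, Holds id ℓ r.1 →
      ∀ p ∈ r.2, ¬ Holds (stored ℓ) ℓ' [p] := fun d hd r hr =>
    hob r (by
      simp only [rules, List.mem_cons, List.mem_flatMap, List.mem_append]
      exact .inr ⟨d, hd, .inr hr⟩)
  have hsnd := hob _ (List.mem_cons_self)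
  clear hob
  rcases q with _ | d
  · rcases k with _ | ⟨⟨t, l⟩, k⟩
    · simp [Cfg.next] at h
    obtain ⟨ht, h6, h7, h8⟩ := hk.head hW hℓ
    cases t with
    | fst f =>
      specialize hframe f ht
      simp [frameRules, Tag.num_inj, List.forall_mem_cons, Ctl.here, Ctl.away, Tag.top, Tag.push,
        holds_eq, holds_ne, holds_nil, stored_const, stored_comp, hq, h6, -List.mem_cons,
        -Prod.forall] at hframe
      obtain ⟨e0, e1, e6, e7, e8⟩ := hframe
      cases h
      exact ⟨ht, e0.symm, e1 ▸ h7, .cons hℓ' trivial e6.symm (e7 ▸ hv) (e8 ▸ h8)⟩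
    | snd =>
      simp [List.forall_mem_cons, Ctl.here, Ctl.away, Tag.top, holds_eq, holds_ne, holds_nil,
        stored_const, stored_comp, hq, h6, -List.mem_cons, -Prod.forall] at hsnd
      obtain ⟨e0, e2, e3, e5⟩ := hsnd
      cases h
      exact ⟨trivial, e0.symm, .cons hℓ' (e2 ▸ hv'.1) (e3 ▸ h7), e5 ▸ h8⟩
    | cmp f =>
      specialize hframe f ht
      simp [frameRules, Tag.num_inj, List.forall_mem_cons, Ctl.here, Ctl.away, Tag.top, Tag.push,
        holds_eq, holds_ne, holds_nil, stored_const, stored_comp, hq, h6, -List.mem_cons,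
        -Prod.forall] at hframe
      obtain ⟨e0, e1, e5⟩ := hframe
      cases h
      exact ⟨ht, e0.symm, e1 ▸ hv, e5 ▸ h8⟩
    | fx f =>
      specialize hframe f ht
      simp [frameRules, Tag.num_inj, List.forall_mem_cons, Ctl.here, Ctl.away, Tag.top, Tag.push,
        holds_eq, holds_ne, holds_nil, stored_const, stored_comp, hq, h6, -List.mem_cons,
        -Prod.forall] at hframe
      by_cases h0 : v.headI = 0
      · obtain ⟨e0, e1, e5⟩ := hframe.1 (hv'.1.eq_nine_iff.2 h0).symm
        simp only [Cfg.next, h0, if_true] at h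
        cases h
        exact ⟨trivial, e0.symm, e1 ▸ hv'.2, e5 ▸ h8⟩
      · obtain ⟨e0, e1, e5⟩ := hframe.2 fun h' => h0 (hv'.1.eq_nine_iff.1 h'.symm)
        simp only [Cfg.next, h0, if_false] at h
        cases h
        exact ⟨ht, e0.symm, e1 ▸ hv'.2, e5 ▸ hk⟩
  · specialize hcode d hs
    have hsub : ∀ e ∈ subs d, e ∈ subs c := fun e he => subs_trans he hs
    cases d with
    | zero' =>
      simp [codeRules, List.forall_mem_cons, Ctl.here, Ctl.away, holds_eq, holds_ne, holds_nil,
        stored_const, stored_nine, stored_comp, hq, -List.mem_cons, -Prod.forall] at hcode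
      obtain ⟨e0, e2, e3, e5⟩ := hcode
      cases h
      exact ⟨trivial, e0.symm, .cons hℓ' (e2 ▸ .zero x W) (e3 ▸ hv), e5 ▸ hk⟩
    | succ =>
      simp [codeRules, List.forall_mem_cons, Ctl.here, Ctl.away, holds_eq, holds_ne, holds_nil,
        stored_const, stored_nine, stored_comp, hq, -List.mem_cons, -Prod.forall] at hcode
      obtain ⟨e0, hne, e4, e3, e5⟩ := hcode
      cases h
      exact ⟨trivial, e0.symm,
        .cons hℓ' (.succ hℓ' (Ne.symm hne) (e4 ▸ hv'.1)) (e3 ▸ .nil), e5 ▸ hk⟩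
    | tail =>
      simp [codeRules, List.forall_mem_cons, Ctl.here, Ctl.away, holds_eq, holds_ne, holds_nil,
        stored_const, stored_comp, hq, -List.mem_cons, -Prod.forall] at hcode
      obtain ⟨e0, e1, e5⟩ := hcode
      cases h
      exact ⟨trivial, e0.symm, e1 ▸ hv'.2, e5 ▸ hk⟩
    | cons f g =>
      simp [codeRules, List.forall_mem_cons, Ctl.here, Ctl.away, Tag.push, holds_eq, holds_ne,
        holds_nil, stored_const, stored_comp, hq, -List.mem_cons, -Prod.forall] at hcode
      obtain ⟨e0, e1, e6, e7, e8⟩ := hcode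
      cases h
      exact ⟨hsub g (by simp [subs, mem_subs_self]), e0.symm, e1 ▸ hv,
        .cons hℓ' (hsub f (by simp [subs, mem_subs_self])) e6.symm (e7 ▸ hv) (e8 ▸ hk)⟩
    | comp f g =>
      simp [codeRules, List.forall_mem_cons, Ctl.here, Ctl.away, Tag.push, holds_eq, holds_ne,
        holds_nil, stored_const, stored_comp, hq, -List.mem_cons, -Prod.forall] at hcode
      obtain ⟨e0, e1, e6, e7, e8⟩ := hcode
      cases h
      exact ⟨hsub g (by simp [subs, mem_subs_self]), e0.symm, e1 ▸ hv,
        .cons hℓ' (hsub f (by simp [subs, mem_subs_self])) e6.symm (e7 ▸ hv) (e8 ▸ hk)⟩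
    | case f g =>
      simp [codeRules, List.forall_mem_cons, Ctl.here, Ctl.away, holds_eq, holds_ne, holds_nil,
        stored_const, stored_comp, hq, -List.mem_cons, -Prod.forall] at hcode
      by_cases h0 : v.headI = 0
      · obtain ⟨e0, e1, e5⟩ := hcode.1 (hv'.1.eq_nine_iff.2 h0).symm
        simp only [Cfg.next, h0, if_true] at h
        cases h
        exact ⟨hsub f (by simp [subs, mem_subs_self]), e0.symm, e1 ▸ hv'.2, e5 ▸ hk⟩
      · obtain ⟨e0, e2, e3, e5⟩ := hcode.2 fun h' => h0 (hv'.1.eq_nine_iff.1 h'.symm)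
        simp only [Cfg.next, h0, if_false] at h
        cases h
        exact ⟨hsub g (by simp [subs, mem_subs_self]), e0.symm,
          .cons hℓ' (e2 ▸ hv'.1.pred hW hℓ h0) (e3 ▸ hv'.2), e5 ▸ hk⟩
    | fix f =>
      simp [codeRules, List.forall_mem_cons, Ctl.here, Ctl.away, Tag.push, holds_eq, holds_ne,
        holds_nil, stored_const, stored_comp, hq, -List.mem_cons, -Prod.forall] at hcode
      obtain ⟨e0, e1, e6, e7, e8⟩ := hcode
      cases h
      exact ⟨hsub f (by simp [subs, mem_subs_self]), e0.symm, e1 ▸ hv,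
        .cons hℓ' (hsub f (by simp [subs, mem_subs_self])) e6.symm (e7 ▸ hv) (e8 ▸ hk)⟩

theorem Rep.next_eq_none {a : Cfg} (hW : ¬ (errors c x).Occur W) (hℓ : ℓ ∈ W) (ha : Rep c x W ℓ a)
    (hlast : ¬ ∃ g ∈ (errors c x).last, Holds id ℓ g) : a.next = none := by
  obtain ⟨q, v, k⟩ := a
  obtain ⟨-, hq, -, hk⟩ := ha
  simp only [errors, List.mem_cons, List.not_mem_nil, or_false, exists_eq_or_imp,
    exists_eq_left, holds_ne, holds_nil, and_true, id, not_or, not_not] at hlast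
  cases q with
  | run d => simp [hq, Ctl.num] at hlast
  | ret =>
    rcases k with _ | ⟨⟨t, l⟩, k⟩
    · rfl
    · have h6 := (hk.head hW hℓ).2.1
      have := t.num_pos
      omega

theorem Rep.halts (hW : ¬ (errors c x).Occur W) {w : List (ℕ → ℕ)} :
    ∀ {ℓ : ℕ → ℕ} {a : Cfg}, ¬ (errors c x).Occur (ℓ :: w) → (∀ ℓ' ∈ ℓ :: w, ℓ' ∈ W) →
      Rep c x W ℓ a → Halts a := by
  induction w with
  | nil =>
    intro ℓ a h hw ha
    exact ⟨0, ha.next_eq_none hW (hw ℓ (.head _)) fun h' => h (.inr (.inl ⟨rfl, h'⟩))⟩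
  | cons ℓ' w ih =>
    intro ℓ a h hw ha
    rcases hb : a.next with _ | b
    · exact ⟨0, hb⟩
    · have hob : Obeys (rules c) ℓ ℓ' := by
        by_contra hob
        obtain ⟨r, hr, h₁, h₂⟩ := exists_succ_iff.2 hob
        exact h (.inr (.inr (.inr (.inl ⟨r, hr, h₁, ℓ', rfl, h₂⟩))))
      exact Halts.of_next hb (ih (fun h' => h (.inr (.inr (.inr (.inr h')))))
        (fun u hu => hw u (.tail _ hu))
        (ha.next hW (hw ℓ (.head _)) (hw ℓ' (.tail _ (.head _))) hob hb))

end Sound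

theorem halts_iff_exists_word (c : Code) (x : ℕ) : Halts ⟨.run c, [x], []⟩ ↔
    ∃ ℓ w, (∀ ℓ' ∈ ℓ :: w, List.length ℓ' = 9) ∧
      ¬ ((∃ g ∈ (errors c x).first, Holds id (comp ℓ) g) ∨
        (errors c x).Occur ((ℓ :: w).map comp)) := by
  constructor
  · rintro ⟨n, hn⟩
    obtain ⟨w, hw⟩ := hn.exists_not_occur c x
    refine ⟨_, w.map Cfg.letter, ?_, not_or.2 ⟨?_, by simpa [Function.comp_def] using hw⟩⟩
    · rw [← List.map_cons (f := Cfg.letter)]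
      intro ℓ' h
      obtain ⟨b, -, rfl⟩ := List.mem_map.1 h
      rfl
    · simp [errors, holds_ne, holds_nil, comp, Cfg.letter, Cfg.frames]
  · rintro ⟨ℓ, w, -, h⟩
    obtain ⟨hf, hW⟩ := not_or.1 h
    simp only [errors, List.mem_cons, List.not_mem_nil, or_false, exists_eq_or_imp,
      exists_eq_left, holds_ne, holds_nil, and_true, id, not_or, not_not] at hf
    obtain ⟨h0, h5, h3, h2⟩ := hf
    refine Rep.halts hW hW (fun _ h => h) ⟨mem_subs_self c, h0.symm, ?_, h5 ▸ .nil⟩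
    exact .cons (.head _) (h2 ▸ .small x le_rfl) (h3 ▸ .nil)

theorem primrec_first (c : Code) : Primrec fun x => (errors c x).first := by
  have h : Primrec fun x : ℕ => [[(false, 9 + x, 2)]] :=
    Primrec.list_cons.comp (Primrec.list_cons.comp ((Primrec.const false).pair
      ((Primrec.nat_add.comp (.const 9) .id).pair (.const 2))) (.const [])) (.const [])
  exact Primrec.list_append.comp
    (.const [[(false, 9 + (Ctl.run c).num, 0)], [(false, 9, 5)], [(false, 9, 3)]]) h

theorem primrec_single (c : Code) : Primrec fun x => (errors c x).single := by
  have h : Primrec fun i : ℕ => [(true, 10 + i, 2), (false, 9 + i, 4)] :=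
    Primrec.list_cons.comp
      ((Primrec.const true).pair ((Primrec.nat_add.comp (.const 10) .id).pair (.const 2)))
      (Primrec.list_cons.comp
        ((Primrec.const false).pair ((Primrec.nat_add.comp (.const 9) .id).pair (.const 4)))
        (.const []))
  exact Primrec.list_append.comp
    (.const [[(true, 9, 1), (false, 9, 2)], [(true, 9, 1), (false, 9, 3)]])
    (Primrec.list_map Primrec.list_range (h.comp .snd).to₂)

theorem primrec_scan (c : Code) (q : ℕ) : Primrec fun x => (errors c x).scan q := by
  have h : Primrec fun g : GuardC => (q, (g, ([] : ActionC)), 2) :=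
    (Primrec.const q).pair
      (((Primrec.id (α := GuardC)).pair (.const ([] : ActionC))).pair (.const 2))
  refine Primrec.list_append.comp (Primrec.list_append.comp (Primrec.list_append.comp
    (Primrec.list_map (primrec_single c) (h.comp .snd).to₂) ?_) ?_) ?_
  · exact .const ((errors c 0).last.map fun g => (q, (g, ([] : ActionC)), 4))
  · exact .const ((errors c 0).succ.map fun r : GuardC × GuardC =>
      (q, (r.1, storeAct), (5 + Encodable.encode r.2 : ℕ)))
  · exact .const [(q, ([], storeAct), 3), (q, ([], []), 1)]

theorem primrec_delta (c : Code) : Primrec fun x => (errors c x).delta := by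
  have h : Primrec fun g : GuardC => (0, (g, ([] : ActionC)), 2) :=
    (Primrec.const 0).pair
      (((Primrec.id (α := GuardC)).pair (.const ([] : ActionC))).pair (.const 2))
  refine Primrec.list_append.comp (Primrec.list_append.comp (Primrec.list_append.comp
    (Primrec.list_append.comp (Primrec.list_append.comp
    (Primrec.list_map (primrec_first c) (h.comp .snd).to₂)
    (primrec_scan c 0)) (primrec_scan c 1)) ?_) ?_) ?_
  · exact .const ((errors c 0).succ.map fun r : GuardC × GuardC =>
      ((5 + Encodable.encode r.2 : ℕ), (r.2, ([] : ActionC)), (2 : ℕ)))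
  · exact .const ((errors c 0).pair.map fun g => (3, (g, ([] : ActionC)), 2))
  · exact .const [(3, ([], []), 3), (2, ([], []), 2)]

theorem primrec_automaton (c : Code) (B k : ℕ) :
    Primrec fun x => (errors c x).automaton (B + x) k := by
  have hm : Primrec fun x => B + x := Primrec.nat_add.comp (.const B) .id
  refine (Primrec.of_equiv_iff toplCEquiv).1 ?_
  exact hm.pair ((Primrec.const 9).pair ((Primrec.const k).pair ((Primrec.const 0).pair
    ((Primrec.list_range.comp hm).pair ((primrec_delta c).pair (.const [0, 2, 4]))))))

theorem halts_iff_not_universal (c : Code) : ∃ B k, ∀ x, Halts ⟨.run c, [x], []⟩ ↔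
    ¬ (((errors c x).automaton (B + x) k).WF ∧ ((errors c x).automaton (B + x) k).Lang =
      fullLang ((errors c x).automaton (B + x) k).n) := by
  obtain ⟨B, hB, hE⟩ := errors_ok c
  obtain ⟨k, hk⟩ : ∃ k, ∀ i ∈ (errors c 0).succ.map fun r => 5 + Encodable.encode r.2, i < k :=
    ⟨_, fun i hi => Nat.lt_succ_of_le (List.le_sum_of_mem hi)⟩
  refine ⟨B, 5 + k, fun x => ?_⟩
  have hwf : ((errors c x).automaton (B + x) (5 + k)).WF :=
    Errors.automaton_wf (hE x) (by omega) (by omega) fun r hr => by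
      have := hk _ (List.mem_map.2 ⟨r, hr, rfl⟩)
      omega
  rw [and_iff_right hwf, Errors.lang_automaton_eq (hE x), halts_iff_exists_word]
  push Not
  rfl

/-- The universality problem for TOPL automata (over `V = ℕ`) is undecidable: the set of
(codes of) well-formed TOPL automata whose language is all of `(V^n)*` is not a computable
predicate. -/
theorem topl_universality_undecidable :
    ¬ ComputablePred fun A : ToplC => A.WF ∧ A.Lang = fullLang A.n := by
  obtain ⟨c, hc⟩ := exists_code_not_computablePred
  obtain ⟨B, k, h⟩ := halts_iff_not_universal c
  intro hA
  refine hc (ComputablePred.computable_of_manyOneReducible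
    ⟨_, (primrec_automaton c B k).to_comp, fun x => ?_⟩ hA.not)
  exact halts_run_iff.symm.trans (h x)

end Topl
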